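/- Let A be an integer m×n matrix, b ∈ ℤ^m, l, u ∈ (ℤ ∪ {±∞})^n, and let f : ℤ^n → ℤ be separable convex. A feasible point x (i.e., x ∈ ℤ^n with Ax = b and l ≤ x ≤ u) minimizes f over the feasible set if and only if there is no g ∈ 𝒢(A) such that x + g is feasible and f(x + g) < f(x); that is, the Graver basis is an optimality certificate for separable convex integer minimization. -/

import Mathlib

/-- The partial order `⊑`: `x ⊑ y` iff `x` lies in the same closed orthant as `y` and
is componentwise bounded by `y` in absolute value. -/
def Conforms {β : Type*} (x y : β → ℤ) : Prop :=
  ∀ i, 0 ≤ x i * y i ∧ |x i| ≤ |y i|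

/-- The Graver basis of an integer matrix `A`: the `⊑`-minimal elements of
`{x : Ax = 0, x ≠ 0}`. -/
def GraverBasis {α β : Type*} [Fintype β] (A : Matrix α β ℤ) : Set (β → ℤ) :=
  {x | A.mulVec x = 0 ∧ x ≠ 0 ∧
    ∀ y : β → ℤ, A.mulVec y = 0 → y ≠ 0 → Conforms y x → y = x}

/-- The extended integers `ℤ ∪ {±∞}`. -/
abbrev ZInfty := WithBot (WithTop ℤ)

/-- The embedding of `ℤ` into `ℤ ∪ {±∞}`. -/
def zc (a : ℤ) : ZInfty := ((a : WithTop ℤ) : ZInfty)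

/-- A function `f : ℤ^β → ℤ` is separable convex if `f(x) = Σ_i f_i(x_i)` with each
`f_i : ℤ → ℤ` convex, i.e. `f_i(a+1) + f_i(a-1) ≥ 2 f_i(a)` for all `a`. -/
def SeparableConvex {β : Type*} [Fintype β] (f : (β → ℤ) → ℤ) : Prop :=
  ∃ fi : β → ℤ → ℤ,
    (∀ i a, 2 * fi i a ≤ fi i (a + 1) + fi i (a - 1)) ∧
    ∀ x, f x = ∑ i, fi i (x i)

theorem zc_le_zc {a b : ℤ} (h : a ≤ b) : zc a ≤ zc b :=
  WithBot.coe_le_coe.2 (WithTop.coe_le_coe.2 h)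

theorem Conforms.cases {β : Type*} {x y : β → ℤ} (h : Conforms x y) (i : β) :
    (0 ≤ x i ∧ x i ≤ y i) ∨ (x i ≤ 0 ∧ y i ≤ x i) := by
  obtain ⟨h1, h2⟩ := h i
  rcases le_total 0 (x i) with hx | hx <;> rcases le_total 0 (y i) with hy | hy
  · rw [abs_of_nonneg hx, abs_of_nonneg hy] at h2
    exact Or.inl ⟨hx, h2⟩
  · rw [abs_of_nonneg hx, abs_of_nonpos hy] at h2
    rcases eq_or_lt_of_le hx with h0 | h0
    · exact Or.inr ⟨by omega, by omega⟩
    · have : y i = 0 := by nlinarith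
      omega
  · rw [abs_of_nonpos hx, abs_of_nonneg hy] at h2
    rcases eq_or_lt_of_le hx with h0 | h0
    · exact Or.inl ⟨by omega, by omega⟩
    · have : y i = 0 := by nlinarith
      omega
  · rw [abs_of_nonpos hx, abs_of_nonpos hy] at h2
    exact Or.inr ⟨hx, by omega⟩

theorem conforms_of_cases {β : Type*} {x y : β → ℤ}
    (h : ∀ i, (0 ≤ x i ∧ x i ≤ y i) ∨ (x i ≤ 0 ∧ y i ≤ x i)) : Conforms x y := by
  intro i
  rcases h i with ⟨h1, h2⟩ | ⟨h1, h2⟩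
  · exact ⟨mul_nonneg h1 (h1.trans h2), abs_le_abs_of_nonneg h1 h2⟩
  · exact ⟨mul_nonneg_of_nonpos_of_nonpos h1 (h2.trans h1), abs_le_abs_of_nonpos h1 h2⟩

theorem Conforms.refl {β : Type*} (x : β → ℤ) : Conforms x x :=
  fun i => ⟨mul_self_nonneg (x i), le_rfl⟩

theorem Conforms.trans {β : Type*} {x y z : β → ℤ} (h : Conforms x y) (h' : Conforms y z) :
    Conforms x z := by
  refine conforms_of_cases fun i => ?_
  have := h.cases i
  have := h'.cases i
  omega

theorem Conforms.sub {β : Type*} {x y : β → ℤ} (h : Conforms x y) : Conforms (y - x) y := by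
  refine conforms_of_cases fun i => ?_
  have := h.cases i
  simp only [Pi.sub_apply]
  omega

theorem Conforms.sum_natAbs_lt {β : Type*} [Fintype β] {x y : β → ℤ} (h : Conforms x y)
    (hne : x ≠ y) : ∑ i, (x i).natAbs < ∑ i, (y i).natAbs := by
  obtain ⟨j, hj⟩ := Function.ne_iff.1 hne
  refine Finset.sum_lt_sum (fun i _ => ?_) ⟨j, Finset.mem_univ j, ?_⟩
  · have := h.cases i
    omega
  · have := h.cases j
    omega

theorem exists_mem_graverBasis_conforms {α β : Type*} [Fintype β] (A : Matrix α β ℤ)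
    (z : β → ℤ) (hz : A.mulVec z = 0) (hz0 : z ≠ 0) : ∃ g ∈ GraverBasis A, Conforms g z := by
  induction hN : ∑ i, (z i).natAbs using Nat.strong_induction_on generalizing z with
  | _ N ih =>
    by_cases hmin : ∀ y : β → ℤ, A.mulVec y = 0 → y ≠ 0 → Conforms y z → y = z
    · exact ⟨z, ⟨hz, hz0, hmin⟩, Conforms.refl z⟩
    · push Not at hmin
      obtain ⟨y, hy, hy0, hyz, hne⟩ := hmin
      obtain ⟨g, hg, hgy⟩ := ih _ (hN ▸ hyz.sum_natAbs_lt hne) y hy hy0 rfl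
      exact ⟨g, hg, hgy.trans hyz⟩

theorem int_convex_increment_mono {φ : ℤ → ℤ} (h : ∀ a, 2 * φ a ≤ φ (a + 1) + φ (a - 1))
    {a b : ℤ} (hab : a ≤ b) : φ (a + 1) - φ a ≤ φ (b + 1) - φ b := by
  refine monotone_int_of_le_succ (f := fun a => φ (a + 1) - φ a) (fun c => ?_) hab
  have := h (c + 1)
  rw [add_sub_cancel_right] at this
  omega

theorem int_convex_superadditive_of_nonneg {φ : ℤ → ℤ}
    (h : ∀ a, 2 * φ a ≤ φ (a + 1) + φ (a - 1)) (a : ℤ) {c d : ℤ} (hc : 0 ≤ c) (hd : 0 ≤ d) :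
    φ (a + c) + φ (a + d) ≤ φ (a + c + d) + φ a := by
  induction d, hd using Int.leInduction with
  | base => simp
  | succ d hd ih =>
    have := int_convex_increment_mono h (show a + d ≤ a + c + d by omega)
    rw [← add_assoc, ← add_assoc]
    omega

theorem SeparableConvex.superadditive {β : Type*} [Fintype β] {f : (β → ℤ) → ℤ}
    (hf : SeparableConvex f) (x : β → ℤ) {g z : β → ℤ} (h : Conforms g z) :
    f (x + (z - g)) + f (x + g) ≤ f (x + z) + f x := by
  obtain ⟨φ, hφ, hfφ⟩ := hf
  simp only [hfφ, ← Finset.sum_add_distrib]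
  refine Finset.sum_le_sum fun i _ => ?_
  simp only [Pi.add_apply, Pi.sub_apply]
  rcases h.cases i with ⟨h1, h2⟩ | ⟨h1, h2⟩
  · have := int_convex_superadditive_of_nonneg (hφ i) (x i) (sub_nonneg.2 h2) h1
    rwa [add_assoc, sub_add_cancel] at this
  · have := int_convex_superadditive_of_nonneg (hφ i) (x i + z i)
      (neg_nonneg.2 h1) (sub_nonneg.2 h2)
    rw [show x i + z i + -g i = x i + (z i - g i) by ring,
      show x i + z i + (g i - z i) = x i + g i by ring,
      show x i + (z i - g i) + (g i - z i) = x i by ring] at this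
    omega

theorem SeparableConvex.le_of_forall_graverBasis {α β : Type*} [Fintype β] (A : Matrix α β ℤ)
    {f : (β → ℤ) → ℤ} (hf : SeparableConvex f) (x z : β → ℤ) (hz : A.mulVec z = 0)
    (h : ∀ g ∈ GraverBasis A, Conforms g z → f x ≤ f (x + g)) : f x ≤ f (x + z) := by
  induction hN : ∑ i, (z i).natAbs using Nat.strong_induction_on generalizing z with
  | _ N ih =>
    by_cases hz0 : z = 0
    · simp [hz0]
    obtain ⟨g, hg, hgz⟩ := exists_mem_graverBasis_conforms A z hz hz0
    have hne : z - g ≠ z := fun e => hg.2.1 (sub_eq_self.1 e)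
    have h1 := ih _ (hN ▸ hgz.sub.sum_natAbs_lt hne) (z - g)
      (by rw [Matrix.mulVec_sub, hz, hg.1, sub_zero])
      (fun g' hg' hc => h g' hg' (hc.trans hgz.sub)) rfl
    have h2 := hf.superadditive x hgz
    have h3 := h g hg hgz
    omega

/-- The Graver basis is an optimality certificate for separable convex integer
minimization: a feasible `x` minimizes `f` over `{y ∈ ℤ^n : Ay = b, l ≤ y ≤ u}` iff
there is no `g ∈ 𝒢(A)` such that `x + g` is feasible and `f(x + g) < f(x)`. -/
theorem graver_optimality_certificate (m n : ℕ) (A : Matrix (Fin m) (Fin n) ℤ)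
    (b : Fin m → ℤ) (l u : Fin n → ZInfty)
    (f : (Fin n → ℤ) → ℤ) (hf : SeparableConvex f) (x : Fin n → ℤ)
    (hx : A.mulVec x = b ∧ ∀ i, l i ≤ zc (x i) ∧ zc (x i) ≤ u i) :
    (∀ y : Fin n → ℤ,
        (A.mulVec y = b ∧ ∀ i, l i ≤ zc (y i) ∧ zc (y i) ≤ u i) → f x ≤ f y) ↔
      ¬∃ g ∈ GraverBasis A,
        (A.mulVec (x + g) = b ∧ ∀ i, l i ≤ zc ((x + g) i) ∧ zc ((x + g) i) ≤ u i) ∧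
        f (x + g) < f x := by
  constructor
  · rintro h ⟨g, -, hfeas, hlt⟩
    exact (h _ hfeas).not_gt hlt
  · intro h y hy
    have key := hf.le_of_forall_graverBasis A x (y - x)
      (by rw [Matrix.mulVec_sub, hy.1, hx.1, sub_self]) fun g hg hgz => ?_
    · rwa [add_sub_cancel] at key
    by_contra hlt
    refine h ⟨g, hg, ⟨by rw [Matrix.mulVec_add, hx.1, hg.1, add_zero], fun i => ?_⟩,
      not_le.1 hlt⟩
    obtain ⟨hlx, hxu⟩ := hx.2 i
    obtain ⟨hly, hyu⟩ := hy.2 i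
    have hc := hgz.cases i
    rw [Pi.sub_apply] at hc
    rw [Pi.add_apply]
    rcases hc with ⟨h1, h2⟩ | ⟨h1, h2⟩
    · exact ⟨hlx.trans (zc_le_zc (by omega)), (zc_le_zc (by omega)).trans hyu⟩
    · exact ⟨hly.trans (zc_le_zc (by omega)), (zc_le_zc (by omega)).trans hxu⟩
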